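/- Let R be a commutative ℚ-algebra, α₀ ∈ R with both α₀ and 1 − α₀ units of R, and α₁, α₂ ∈ R. Then in R[t]/(t³): 1 − α₀·exp(α₁t + α₂t²) = (1 − α₀)·exp( (α₀α₁/(α₀ − 1))·t + (α₀α₂/(α₀ − 1) − α₀α₁²/(2(α₀ − 1)²))·t² ). -/

import Mathlib

noncomputable section

/-- The truncated polynomial ring `R[t]/(t³)`. -/
abbrev T3 (R : Type*) [CommRing R] := Polynomial R ⧸ Ideal.span {(Polynomial.X : Polynomial R) ^ 3}

/-- The class of `t` in `R[t]/(t³)`. -/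
def tE (R : Type*) [CommRing R] : T3 R := Ideal.Quotient.mk _ Polynomial.X

/-- The constant `x` viewed in `R[t]/(t³)`. -/
def cE {R : Type*} [CommRing R] (x : R) : T3 R := algebraMap R (T3 R) x

/-- The truncated exponential `exp(u) = 1 + u + u²/2` on `R[t]/(t³)` for a commutative
`ℚ`-algebra `R`, well defined for `u` in the ideal `(t)`. -/
def expE {R : Type*} [CommRing R] [Algebra ℚ R] (u : T3 R) : T3 R :=
  1 + u + algebraMap ℚ (T3 R) (2⁻¹ : ℚ) * u ^ 2

lemma tE_pow_three (R : Type*) [CommRing R] : tE R ^ 3 = 0 := by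
  rw [tE, ← map_pow]
  exact Ideal.Quotient.eq_zero_iff_mem.mpr (Ideal.mem_span_singleton_self _)

/-- The formula for the exponential parameters of `1 - A * exp (b * T + c * T ^ 2)`, in any
commutative ring, where `I` and `H` play the roles of `(A - 1)⁻¹` and `1 / 2`. -/
lemma one_sub_mul_exp_of_pow_three_eq_zero {S : Type*} [CommRing S] {A b c I H T : S}
    (hI : (A - 1) * I = 1) (hT : T ^ 3 = 0) :
    1 - A * (1 + (b * T + c * T ^ 2) + H * (b * T + c * T ^ 2) ^ 2)
      = (1 - A) * (1 + (A * b * I * T + (A * c * I - A * b ^ 2 * (H * I ^ 2)) * T ^ 2)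
          + H * (A * b * I * T + (A * c * I - A * b ^ 2 * (H * I ^ 2)) * T ^ 2) ^ 2) := by
  linear_combination
    (A * b * T + (A * c + A * b ^ 2 * H * ((A - 1) * I + 1)) * T ^ 2) * hI
    + (-A * H * (2 * b * c + c ^ 2 * T)
        - (1 - A) * H * (2 * (A * b * I) * (A * c * I - A * b ^ 2 * (H * I ^ 2))
          + (A * c * I - A * b ^ 2 * (H * I ^ 2)) ^ 2 * T)) * hT

lemma Ring.inverse_two_mul_sq {R : Type*} [CommRing R] [Algebra ℚ R] (x : R) :
    Ring.inverse (2 * x ^ 2) = algebraMap ℚ R 2⁻¹ * Ring.inverse x ^ 2 := by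
  have h2 : algebraMap ℚ R 2⁻¹ * 2 = 1 := by
    rw [← map_ofNat (algebraMap ℚ R) 2, ← map_mul]
    norm_num
  have hinv : Ring.inverse (2 : R) = algebraMap ℚ R 2⁻¹ :=
    Ring.inverse_unit ⟨2, algebraMap ℚ R 2⁻¹, (mul_comm _ _).trans h2, h2⟩
  rw [Ring.mul_inverse_rev, ← Ring.inverse_pow, mul_comm, hinv]

/-- Let `R` be a commutative `ℚ`-algebra, `α₀ ∈ R` with both `α₀` and
`1 − α₀` units of `R`, and `α₁, α₂ ∈ R`.  Then in `R[t]/(t³)`: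
`1 − α₀·exp(α₁t + α₂t²)
  = (1 − α₀)·exp((α₀α₁/(α₀ − 1))·t + (α₀α₂/(α₀ − 1) − α₀α₁²/(2(α₀ − 1)²))·t²)`
(the divisions by the units `α₀ − 1`, `2(α₀ − 1)²` are expressed via `Ring.inverse`). -/
theorem statement_9 {R : Type*} [CommRing R] [Algebra ℚ R]
    (α₀ α₁ α₂ : R) (h0 : IsUnit α₀) (h1 : IsUnit (1 - α₀)) :
    1 - cE α₀ * expE (cE α₁ * tE R + cE α₂ * tE R ^ 2)
      = cE (1 - α₀)
          * expE (cE (α₀ * α₁ * Ring.inverse (α₀ - 1)) * tE R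
            + cE (α₀ * α₂ * Ring.inverse (α₀ - 1)
                - α₀ * α₁ ^ 2 * Ring.inverse (2 * (α₀ - 1) ^ 2)) * tE R ^ 2) := by
  have hu : IsUnit (α₀ - 1) := by simpa using h1.neg
  have hI : (cE α₀ - 1) * cE (Ring.inverse (α₀ - 1)) = 1 := by
    simpa [cE] using congrArg (algebraMap R (T3 R)) (Ring.mul_inverse_cancel _ hu)
  have hH : algebraMap ℚ (T3 R) 2⁻¹ = cE (algebraMap ℚ R 2⁻¹) :=
    IsScalarTower.algebraMap_apply ℚ R (T3 R) _
  rw [Ring.inverse_two_mul_sq, expE, expE, hH]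
  simp only [cE, map_mul, map_sub, map_pow, map_one] at hI ⊢
  exact one_sub_mul_exp_of_pow_three_eq_zero hI (tE_pow_three R)

end
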